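/- Let S be a finite type (system qubits) and B a finite type (bath qubits). For each l ∈ S let 𝓘_l be a finite set of nonempty subsets I ⊆ B, with a phase φ(l,I) ∈ ℝ for each such I (no condition on overlaps between the families is assumed). Let U be the diagonal unitary on the index type (S → Fin 2) × (B → Fin 2) whose diagonal entry at (s,k) is exp(i·Σ_{l∈S} Σ_{I∈𝓘_l} φ(l,I)·(s l)·Π_{i∈I}(k i)) (bits regarded as 0/1 reals). Then the completely positive map E(ρ) = tr_B( U (ρ ⊗ Q_B) Uᴴ ) on matrices ρ indexed by (S → Fin 2) satisfies E(ρ) = 2^{−|B|}·Σ_{k : B → Fin 2} W_k ρ W_kᴴ, where W_k is the tensor product of single-qubit phase gates given entrywise by W_k(s,s') = Π_{l∈S} ( u(β_l(k)) )_{s l, s' l} with β_l(k) = Σ_{I∈𝓘_l} φ(l,I)·Π_{i∈I}(k i). In particular, every purely dephasing map (one in which each pure phase gate acts on exactly one system qubit) is separable: it is a convex combination of conjugations by tensor products of single-qubit unitaries. -/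

import Mathlib

open Matrix
open scoped Kronecker

noncomputable section

/-- The single-qubit phase gate `u(θ) = diag(1, e^{iθ})`. -/
def phaseGate (θ : ℝ) : Matrix (Fin 2) (Fin 2) ℂ :=
  Matrix.diagonal fun j => if j = 1 then Complex.exp (Complex.I * (θ : ℂ)) else 1

/-- A tensor product of single-qubit phase gates is diagonal, with the total phase accumulated
by the excited qubits on the diagonal. -/
theorem prod_phaseGate_eq_diagonal {S : Type*} [Fintype S] [DecidableEq S] (θ : S → ℝ) :
    (Matrix.of fun s s' : S → Fin 2 => ∏ l, phaseGate (θ l) (s l) (s' l)) =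
      Matrix.diagonal fun s =>
        Complex.exp (Complex.I * ((∑ l, ((s l : ℕ) : ℝ) * θ l : ℝ) : ℂ)) := by
  ext s s'
  rw [Matrix.of_apply]
  by_cases h : s = s'
  · subst h
    rw [Matrix.diagonal_apply_eq, Complex.ofReal_sum, Finset.mul_sum, Complex.exp_sum]
    refine Finset.prod_congr rfl fun l _ => ?_
    rw [phaseGate, Matrix.diagonal_apply_eq]
    generalize s l = j
    fin_cases j <;> simp
  · rw [Matrix.diagonal_apply_ne _ h]
    obtain ⟨l, hl⟩ := Function.ne_iff.mp h
    exact Finset.prod_eq_zero (Finset.mem_univ l) (Matrix.diagonal_apply_ne _ hl)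

/-- Every purely dephasing map (each pure phase gate couples exactly one
system qubit to a set of bath qubits) is separable: with the bath prepared in
`|+⟩^{⊗|B|}`, `E(ρ) = 2^{-|B|} Σ_k W_k ρ W_kᴴ` where each `W_k` is a tensor product of
single-qubit phase gates `u(β_l(k))`. -/
theorem purely_dephasing_map_separable
    {S B : Type*} [Fintype S] [DecidableEq S] [Fintype B] [DecidableEq B]
    (𝓘 : S → Finset (Finset B)) (hne : ∀ l, ∀ J ∈ 𝓘 l, J.Nonempty)
    (φ : S → Finset B → ℝ)
    (U : Matrix ((S → Fin 2) × (B → Fin 2)) ((S → Fin 2) × (B → Fin 2)) ℂ)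
    (hU : U = Matrix.diagonal fun p =>
      Complex.exp (Complex.I *
        ((∑ l, ∑ J ∈ 𝓘 l, φ l J * ((p.1 l : ℕ) : ℝ) * ∏ i ∈ J, ((p.2 i : ℕ) : ℝ) : ℝ) : ℂ)))
    (Q : Matrix (B → Fin 2) (B → Fin 2) ℂ)
    (hQ : Q = Matrix.of fun _ _ => ((2 : ℂ) ^ Fintype.card B)⁻¹)
    (E : Matrix (S → Fin 2) (S → Fin 2) ℂ → Matrix (S → Fin 2) (S → Fin 2) ℂ)
    (hE : ∀ ρ, E ρ = Matrix.of fun s s' =>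
      ∑ b : B → Fin 2, (U * (ρ ⊗ₖ Q) * Uᴴ) (s, b) (s', b))
    (β : S → (B → Fin 2) → ℝ)
    (hβ : ∀ l k, β l k = ∑ J ∈ 𝓘 l, φ l J * ∏ i ∈ J, ((k i : ℕ) : ℝ))
    (W : (B → Fin 2) → Matrix (S → Fin 2) (S → Fin 2) ℂ)
    (hW : ∀ k, W k = Matrix.of fun s s' => ∏ l, (phaseGate (β l k)) (s l) (s' l)) :
    ∀ ρ : Matrix (S → Fin 2) (S → Fin 2) ℂ,
      E ρ = ((2 : ℂ) ^ Fintype.card B)⁻¹ • ∑ k : B → Fin 2, W k * ρ * (W k)ᴴ := by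
  intro ρ
  have hphase (s : S → Fin 2) (k : B → Fin 2) :
      ∑ l, ∑ J ∈ 𝓘 l, φ l J * ((s l : ℕ) : ℝ) * ∏ i ∈ J, ((k i : ℕ) : ℝ) =
        ∑ l, ((s l : ℕ) : ℝ) * β l k := by
    refine Finset.sum_congr rfl fun l _ => ?_
    rw [hβ, Finset.mul_sum]
    exact Finset.sum_congr rfl fun J _ => by ring
  ext s s'
  simp only [hE, hU, hQ, hW, hphase, prod_phaseGate_eq_diagonal, Matrix.diagonal_conjTranspose,
    Matrix.mul_diagonal, Matrix.diagonal_mul, Matrix.of_apply, Matrix.kroneckerMap_apply,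
    Matrix.smul_apply, Matrix.sum_apply, Pi.star_apply, smul_eq_mul, Finset.mul_sum]
  exact Finset.sum_congr rfl fun k _ => by ring

end
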